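/- arXiv:2409.17314 — 4 statements merged into one kernel-verified Lean document; each statement's English description precedes it below -/
import Mathlib

section
/- Let H and Q be real Hilbert spaces, let a : H × H → ℝ and b : H × Q → ℝ be bounded bilinear forms, and let ν, c₁, γ, C_a, β̂ > 0 be constants such that: |a(σ,τ)| ≤ C_a‖σ‖‖τ‖ for all σ, τ ∈ H; a(τ,τ) ≥ (c₁/ν)‖τ‖² for all τ in the kernel K of b; and b satisfies the inf-sup condition with constant γ. Let f, w₁, w₂ ∈ Q and suppose that for i = 1, 2 the pairs (σᵢ, uᵢ) ∈ H × Q satisfy a(σᵢ,τ) + b(τ,uᵢ) = G_i(τ) for all τ ∈ H and b(σᵢ,v) = −(f,v)_Q for all v ∈ Q, where G₁, G₂ are linear functionals on H with |G₁(τ) − G₂(τ)| ≤ (β̂/ν)‖w₁ − w₂‖‖τ‖ for all τ ∈ H. Then ‖σ₁ − σ₂‖ ≤ (β̂/c₁)‖w₁ − w₂‖ and ‖u₁ − u₂‖ ≤ (β̂/γ)(1/ν + C_a/c₁)‖w₁ − w₂‖. -/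
open scoped RealInnerProductSpace

/-- Lipschitz continuity of the fixed-point map (Lemma 2.3):
if `(σᵢ, uᵢ)` solve the linearized saddle-point problems with right-hand sides `Gᵢ`
satisfying `|G₁(τ) − G₂(τ)| ≤ (β̂/ν)‖w₁ − w₂‖‖τ‖`, and the same datum `f`, then
`‖σ₁ − σ₂‖ ≤ (β̂/c₁)‖w₁ − w₂‖` and `‖u₁ − u₂‖ ≤ (β̂/γ)(1/ν + C_a/c₁)‖w₁ − w₂‖`. -/
theorem statement6 {H Q : Type*}
    [NormedAddCommGroup H] [InnerProductSpace ℝ H] [CompleteSpace H]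
    [NormedAddCommGroup Q] [InnerProductSpace ℝ Q] [CompleteSpace Q]
    (a : H →ₗ[ℝ] H →ₗ[ℝ] ℝ) (b : H →ₗ[ℝ] Q →ₗ[ℝ] ℝ)
    (ν c₁ γ Ca βhat : ℝ)
    (hν : 0 < ν) (hc₁ : 0 < c₁) (hγ : 0 < γ) (hCa : 0 < Ca) (hβ : 0 < βhat)
    (ha_bdd : ∀ σ τ : H, |a σ τ| ≤ Ca * ‖σ‖ * ‖τ‖)
    (ha_coer : ∀ τ : H, (∀ v : Q, b τ v = 0) → (c₁ / ν) * ‖τ‖ ^ 2 ≤ a τ τ)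
    (hb_infsup : ∀ q : Q, γ * ‖q‖ ≤ ⨆ τ : {τ : H // τ ≠ 0}, |b τ.1 q| / ‖τ.1‖)
    (f w₁ w₂ : Q) (G₁ G₂ : H →ₗ[ℝ] ℝ)
    (hG : ∀ τ : H, |G₁ τ - G₂ τ| ≤ (βhat / ν) * ‖w₁ - w₂‖ * ‖τ‖)
    (σ₁ σ₂ : H) (u₁ u₂ : Q)
    (h1a : ∀ τ : H, a σ₁ τ + b τ u₁ = G₁ τ)
    (h1b : ∀ v : Q, b σ₁ v = -⟪f, v⟫)
    (h2a : ∀ τ : H, a σ₂ τ + b τ u₂ = G₂ τ)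
    (h2b : ∀ v : Q, b σ₂ v = -⟪f, v⟫) :
    ‖σ₁ - σ₂‖ ≤ (βhat / c₁) * ‖w₁ - w₂‖ ∧
    ‖u₁ - u₂‖ ≤ (βhat / γ) * (1 / ν + Ca / c₁) * ‖w₁ - w₂‖ := by
  have hW : 0 ≤ ‖w₁ - w₂‖ := norm_nonneg _
  have hker : ∀ v : Q, b (σ₁ - σ₂) v = 0 := by
    intro v
    simp [h1b, h2b]
  have herr : ∀ τ : H, a (σ₁ - σ₂) τ + b τ (u₁ - u₂) = G₁ τ - G₂ τ := by
    intro τ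
    rw [← h1a, ← h2a]
    simp only [map_sub, LinearMap.sub_apply]
    ring
  have hσ : ‖σ₁ - σ₂‖ ≤ (βhat / c₁) * ‖w₁ - w₂‖ := by
    rcases (norm_nonneg (σ₁ - σ₂)).eq_or_lt with h0 | hpos
    · rw [← h0]
      positivity
    · have h1 := ha_coer _ hker
      have h2 := herr (σ₁ - σ₂)
      rw [hker, add_zero] at h2
      have h3 := (le_abs_self _).trans (hG (σ₁ - σ₂))
      rw [← h2] at h3
      have h4 : (c₁ / ν * ‖σ₁ - σ₂‖) * ‖σ₁ - σ₂‖
          ≤ (βhat / ν * ‖w₁ - w₂‖) * ‖σ₁ - σ₂‖ := by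
        calc _ = (c₁ / ν) * ‖σ₁ - σ₂‖ ^ 2 := by ring
          _ ≤ _ := h1.trans h3
      have h5 := le_of_mul_le_mul_right h4 hpos
      have h6 := mul_le_mul_of_nonneg_left h5 (div_pos hν hc₁).le
      calc ‖σ₁ - σ₂‖ = ν / c₁ * (c₁ / ν * ‖σ₁ - σ₂‖) := by field_simp
        _ ≤ ν / c₁ * (βhat / ν * ‖w₁ - w₂‖) := h6
        _ = _ := by field_simp
  refine ⟨hσ, ?_⟩
  have hsup : γ * ‖u₁ - u₂‖ ≤ βhat * (1 / ν + Ca / c₁) * ‖w₁ - w₂‖ := by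
    refine (hb_infsup _).trans (Real.iSup_le ?_ (by positivity))
    rintro ⟨τ, hτ⟩
    have hτp : 0 < ‖τ‖ := norm_pos_iff.mpr hτ
    rw [div_le_iff₀ hτp]
    have e : b τ (u₁ - u₂) = (G₁ τ - G₂ τ) - a (σ₁ - σ₂) τ := by
      rw [← herr]; ring
    have h7 : Ca * ‖σ₁ - σ₂‖ * ‖τ‖ ≤ Ca * ((βhat / c₁) * ‖w₁ - w₂‖) * ‖τ‖ := by
      gcongr
    calc |b τ (u₁ - u₂)| ≤ |G₁ τ - G₂ τ| + |a (σ₁ - σ₂) τ| := by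
          rw [e]; exact abs_sub _ _
      _ ≤ (βhat / ν) * ‖w₁ - w₂‖ * ‖τ‖ + Ca * ((βhat / c₁) * ‖w₁ - w₂‖) * ‖τ‖ :=
          add_le_add (hG τ) ((ha_bdd _ _).trans h7)
      _ = _ := by ring
  calc ‖u₁ - u₂‖ = (γ * ‖u₁ - u₂‖) / γ := by field_simp
    _ ≤ (βhat * (1 / ν + Ca / c₁) * ‖w₁ - w₂‖) / γ := by gcongr
    _ = _ := by ring
end

section
/- Let H and Q be real Hilbert spaces, let a : H × H → ℝ and b : H × Q → ℝ be bilinear forms, and let ν, c₁, γ̂ > 0 be constants such that: |a(σ,τ)| ≤ (1/ν)‖σ‖‖τ‖ for all σ, τ ∈ H; a(τ,τ) ≥ (c₁/ν)‖τ‖² for all τ ∈ H; and for every u ∈ Q there exists σ̃ ∈ H with b(σ̃, v) = −(u, v)_Q for all v ∈ Q and ‖σ̃‖ ≤ (1/γ̂)‖u‖. Define B((σ,u);(τ,v)) := a(σ,τ) + b(τ,u) + b(σ,v). Then for every (σ, u) ∈ H × Q there exists (τ, v) ∈ H × Q such that ‖τ‖² + ‖v‖² ≤ (2 + c₁²γ̂²ν²)(‖σ‖²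 + ‖u‖²) and B((σ,u);(τ,v)) ≥ min{c₁/(2ν), c₁γ̂²ν/2}·(‖σ‖² + ‖u‖²). -/
open scoped RealInnerProductSpace

/-- Inf-sup condition for the convection-free mixed form
`B((σ,u);(τ,v)) := a(σ,τ) + b(τ,u) + b(σ,v)` (Lemma 3.1): under ellipticity of `a`
and the (discrete) inf-sup property of `b` encoded by `σ̃`, for every `(σ,u)` there
is a test pair `(τ,v)` with `‖τ‖² + ‖v‖² ≤ (2 + c₁²γ̂²ν²)(‖σ‖² + ‖u‖²)` and
`B((σ,u);(τ,v)) ≥ min{c₁/(2ν), c₁γ̂²ν/2}·(‖σ‖² + ‖u‖²)`. -/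
theorem statement8 {H Q : Type*}
    [NormedAddCommGroup H] [InnerProductSpace ℝ H] [CompleteSpace H]
    [NormedAddCommGroup Q] [InnerProductSpace ℝ Q] [CompleteSpace Q]
    (a : H →ₗ[ℝ] H →ₗ[ℝ] ℝ) (b : H →ₗ[ℝ] Q →ₗ[ℝ] ℝ)
    (ν c₁ γhat : ℝ) (hν : 0 < ν) (hc₁ : 0 < c₁) (hγ : 0 < γhat)
    (ha_bdd : ∀ σ τ : H, |a σ τ| ≤ (1 / ν) * ‖σ‖ * ‖τ‖)
    (ha_coer : ∀ τ : H, (c₁ / ν) * ‖τ‖ ^ 2 ≤ a τ τ)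
    (hb_lift : ∀ u : Q, ∃ σt : H,
      (∀ v : Q, b σt v = -⟪u, v⟫) ∧ ‖σt‖ ≤ (1 / γhat) * ‖u‖) :
    ∀ (σ : H) (u : Q), ∃ (τ : H) (v : Q),
      ‖τ‖ ^ 2 + ‖v‖ ^ 2 ≤ (2 + c₁ ^ 2 * γhat ^ 2 * ν ^ 2) * (‖σ‖ ^ 2 + ‖u‖ ^ 2) ∧
      min (c₁ / (2 * ν)) (c₁ * γhat ^ 2 * ν / 2) * (‖σ‖ ^ 2 + ‖u‖ ^ 2) ≤
        a σ τ + b τ u + b σ v := by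
  intro σ u
  obtain ⟨t, ht, htn⟩ := hb_lift u
  have hδ : 0 < c₁ * γhat ^ 2 * ν := by positivity
  have hs := norm_nonneg σ
  have hw := norm_nonneg u
  have hk : (c₁ * γhat ^ 2 * ν) * ‖t‖ ≤ c₁ * γhat * ν * ‖u‖ := by
    calc (c₁ * γhat ^ 2 * ν) * ‖t‖ ≤ (c₁ * γhat ^ 2 * ν) * ((1 / γhat) * ‖u‖) := by gcongr
      _ = c₁ * γhat * ν * ‖u‖ := by field_simp
  refine ⟨σ - (c₁ * γhat ^ 2 * ν) • t, -u, ?_, ?_⟩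
  · have h1 : ‖σ - (c₁ * γhat ^ 2 * ν) • t‖ ≤ ‖σ‖ + c₁ * γhat * ν * ‖u‖ := by
      refine (norm_sub_le _ _).trans ?_
      rw [norm_smul, Real.norm_of_nonneg hδ.le]
      linarith
    have h2 : ‖σ - (c₁ * γhat ^ 2 * ν) • t‖ ^ 2 ≤ (‖σ‖ + c₁ * γhat * ν * ‖u‖) ^ 2 := by
      gcongr
    rw [norm_neg]
    nlinarith [sq_nonneg (c₁ * γhat * ν * ‖σ‖ - ‖u‖), sq_nonneg ‖σ‖]
  · have h1 : a σ t ≤ (1 / ν) * ‖σ‖ * ‖t‖ := (le_abs_self _).trans (ha_bdd σ t)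
    have h2 : (c₁ * γhat ^ 2 * ν) * a σ t ≤ c₁ * γhat * ‖σ‖ * ‖u‖ := by
      calc (c₁ * γhat ^ 2 * ν) * a σ t
          ≤ (c₁ * γhat ^ 2 * ν) * ((1 / ν) * ‖σ‖ * ‖t‖) := by gcongr
        _ = (1 / ν) * ‖σ‖ * ((c₁ * γhat ^ 2 * ν) * ‖t‖) := by ring
        _ ≤ (1 / ν) * ‖σ‖ * (c₁ * γhat * ν * ‖u‖) := by gcongr
        _ = c₁ * γhat * ‖σ‖ * ‖u‖ := by field_simp
    have h3 : 0 ≤ c₁ / (2 * ν) * (‖σ‖ - γhat * ν * ‖u‖) ^ 2 := by positivity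
    have h4 : c₁ / (2 * ν) * (‖σ‖ - γhat * ν * ‖u‖) ^ 2
        = c₁ / (2 * ν) * ‖σ‖ ^ 2 - c₁ * γhat * ‖σ‖ * ‖u‖
          + c₁ * γhat ^ 2 * ν / 2 * ‖u‖ ^ 2 := by
      field_simp
      ring
    have h5 := ha_coer σ
    have h6 : c₁ / ν = 2 * (c₁ / (2 * ν)) := by field_simp
    rw [h6] at h5
    have h7 := mul_le_mul_of_nonneg_right
      (min_le_left (c₁ / (2 * ν)) (c₁ * γhat ^ 2 * ν / 2)) (sq_nonneg ‖σ‖)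
    have h8 := mul_le_mul_of_nonneg_right
      (min_le_right (c₁ / (2 * ν)) (c₁ * γhat ^ 2 * ν / 2)) (sq_nonneg ‖u‖)
    simp only [map_sub, map_smul, map_neg, LinearMap.sub_apply, LinearMap.smul_apply,
      smul_eq_mul, ht, real_inner_self_eq_norm_sq]
    linarith
end

section
/- Let H and Q be real Hilbert spaces and equip X := H × Q with the norm ‖(σ,u)‖² := ‖σ‖² + ‖u‖². Let B : X × X → ℝ be a bilinear form, let c : Q × H → ℝ be a bilinear form with |c(u,τ)| ≤ (β̂/ν)‖u‖‖τ‖ for all u ∈ Q, τ ∈ H and constants β̂, ν > 0, and let C_J > 0. Assume that for every (σ,u) ∈ X there exists (τ,v) ∈ X with ‖(τ,v)‖ ≤ ‖(σ,u)‖ and ‖(σ,u)‖² ≤ C_J·B((σ,u);(τ,v)). If C_J·β̂/ν < 1, then for every bounded linear functional L on X, any two pairs (σ₁,u₁), (σ₂,u₂) ∈ X satisfying B((σᵢ,uᵢ);(τ,v)) + c(uᵢ,τ) = L(τ,v) for all (τ,v) ∈ X coincide, i.e. σ₁ = σ₂ and u₁ = u₂. -/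
/-- Uniqueness for the perturbed problem (Lemma 3.2): on
`X := H × Q` with `‖(σ,u)‖² := ‖σ‖² + ‖u‖²`, if `B` satisfies the inf-sup condition
with constant `C_J` (with test pairs no larger than the trial pairs), `c` is bounded
by `β̂/ν`, and `C_J·β̂/ν < 1`, then any two solutions of
`B((σ,u);(τ,v)) + c(u,τ) = L(τ,v)` coincide. -/
theorem statement9 {H Q : Type*}
    [NormedAddCommGroup H] [InnerProductSpace ℝ H] [CompleteSpace H]
    [NormedAddCommGroup Q] [InnerProductSpace ℝ Q] [CompleteSpace Q]
    (B : H × Q →ₗ[ℝ] H × Q →ₗ[ℝ] ℝ) (c : Q →ₗ[ℝ] H →ₗ[ℝ] ℝ)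
    (ν βhat CJ : ℝ) (hν : 0 < ν) (hβ : 0 < βhat) (hCJ : 0 < CJ)
    (hc_bdd : ∀ (u : Q) (τ : H), |c u τ| ≤ (βhat / ν) * ‖u‖ * ‖τ‖)
    (hB_infsup : ∀ p : H × Q, ∃ q : H × Q,
      ‖q.1‖ ^ 2 + ‖q.2‖ ^ 2 ≤ ‖p.1‖ ^ 2 + ‖p.2‖ ^ 2 ∧
      ‖p.1‖ ^ 2 + ‖p.2‖ ^ 2 ≤ CJ * B p q)
    (hsmall : CJ * βhat / ν < 1) :
    ∀ (L : H × Q →L[ℝ] ℝ) (p₁ p₂ : H × Q),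
      (∀ q : H × Q, B p₁ q + c p₁.2 q.1 = L q) →
      (∀ q : H × Q, B p₂ q + c p₂.2 q.1 = L q) →
      p₁ = p₂ := by
  intro L p₁ p₂ h₁ h₂
  obtain ⟨q, hq, hp⟩ := hB_infsup (p₁ - p₂)
  have hz : B (p₁ - p₂) q = - c (p₁ - p₂).2 q.1 := by
    have e₁ := h₁ q
    have e₂ := h₂ q
    simp only [map_sub, LinearMap.sub_apply, Prod.snd_sub]
    linarith
  rw [hz] at hp
  have hb := hc_bdd (p₁ - p₂).2 q.1
  have hb' := neg_le_abs (c (p₁ - p₂).2 q.1)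
  set p := p₁ - p₂ with hpdef
  have hk : 0 < CJ * βhat / ν := by positivity
  have hm : ‖p.2‖ * ‖q.1‖ ≤ ‖p.1‖ ^ 2 + ‖p.2‖ ^ 2 := by
    nlinarith [sq_nonneg (‖p.2‖ - ‖q.1‖), sq_nonneg ‖p.1‖, sq_nonneg ‖q.2‖]
  have h3 : ‖p.1‖ ^ 2 + ‖p.2‖ ^ 2 ≤ CJ * βhat / ν * (‖p.1‖ ^ 2 + ‖p.2‖ ^ 2) := by
    calc _ ≤ CJ * (- c p.2 q.1) := hp
      _ ≤ CJ * ((βhat / ν) * ‖p.2‖ * ‖q.1‖) :=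
        mul_le_mul_of_nonneg_left (hb'.trans hb) hCJ.le
      _ = CJ * βhat / ν * (‖p.2‖ * ‖q.1‖) := by ring
      _ ≤ _ := mul_le_mul_of_nonneg_left hm hk.le
  have h4 : ‖p.1‖ ^ 2 + ‖p.2‖ ^ 2 ≤ 0 := by
    by_contra hn
    push Not at hn
    nlinarith
  have a1 : ‖p.1‖ = 0 := by
    apply pow_eq_zero_iff (two_ne_zero) |>.1
    nlinarith [sq_nonneg ‖p.1‖, sq_nonneg ‖p.2‖]
  have a2 : ‖p.2‖ = 0 := by
    apply pow_eq_zero_iff (two_ne_zero) |>.1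
    nlinarith [sq_nonneg ‖p.1‖, sq_nonneg ‖p.2‖]
  exact sub_eq_zero.1 (Prod.ext (norm_eq_zero.1 a1) (norm_eq_zero.1 a2))
end

section
/- Let H and Q be real Hilbert spaces with closed subspaces H_h ⊆ H and Q_h ⊆ Q. Let a : H × H → ℝ, b : H × Q → ℝ and c : Q × H → ℝ be bilinear forms with |a(σ,τ)| ≤ (1/ν)‖σ‖‖τ‖, |b(τ,v)| ≤ ‖τ‖‖v‖ and |c(u,τ)| ≤ (β̂/ν)‖u‖‖τ‖ for constants ν, β̂ > 0, and set B((σ,u);(τ,v)) := a(σ,τ) + b(τ,u) + b(σ,v). Assume the discrete inf-sup condition: there is C_J > 0 such that for every (σ_h,u_h) ∈ H_h × Q_h there exists (τ_h,v_h) ∈ H_h × Q_h with ‖(τ_h,v_h)‖ ≤ ‖(σ_h,u_h)‖ and ‖(σ_h,u_h)‖² ≤ C_J·B((σ_h,u_h);(τ_h,v_h)), and assume 1/C_J − β̂/ν > 0. Let f ∈ Q and suppose (σ,u) ∈ H × Q satisfies a(σ,τ) + b(τ,u) + c(u,τ) = 0 for all τ ∈ H and b(σ,v) = −(f,v)_Q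 for all v ∈ Q, while (σ_h,u_h) ∈ H_h × Q_h satisfies the same two equations for all τ ∈ H_h and all v ∈ Q_h. Then there exists a constant Ĉ > 0, depending only on ν, β̂ and C_J (and not on f, h, σ, u), such that for every (σ_I, u_I) ∈ H_h × Q_h, ‖σ − σ_h‖² + ‖u − u_h‖² ≤ Ĉ²·(‖σ − σ_I‖² + ‖u − u_I‖²). -/
open scoped RealInnerProductSpace

set_option maxHeartbeats 1600000 in
/-- Céa-type quasi-optimality (heart of Lemma 3.3): under the
boundedness of `a`, `b`, `c`, the discrete inf-sup condition with constant `C_J`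
for `B((σ,u);(τ,v)) := a(σ,τ) + b(τ,u) + b(σ,v)` on closed subspaces `H_h × Q_h`,
and `1/C_J − β̂/ν > 0`, the Galerkin error between the continuous solution `(σ,u)`
and the discrete solution `(σ_h,u_h)` is bounded by a constant `Ĉ` (depending only
on `ν`, `β̂`, `C_J`) times the best-approximation error. -/
theorem statement10 {H Q : Type*}
    [NormedAddCommGroup H] [InnerProductSpace ℝ H] [CompleteSpace H]
    [NormedAddCommGroup Q] [InnerProductSpace ℝ Q] [CompleteSpace Q]
    (ν βhat CJ : ℝ) (hν : 0 < ν) (hβ : 0 < βhat) (hCJ : 0 < CJ)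
    (hsmall : 0 < 1 / CJ - βhat / ν) :
    ∃ Chat : ℝ, 0 < Chat ∧
      ∀ (a : H →ₗ[ℝ] H →ₗ[ℝ] ℝ) (b : H →ₗ[ℝ] Q →ₗ[ℝ] ℝ) (c : Q →ₗ[ℝ] H →ₗ[ℝ] ℝ),
        (∀ σ τ : H, |a σ τ| ≤ (1 / ν) * ‖σ‖ * ‖τ‖) →
        (∀ (τ : H) (v : Q), |b τ v| ≤ ‖τ‖ * ‖v‖) →
        (∀ (u : Q) (τ : H), |c u τ| ≤ (βhat / ν) * ‖u‖ * ‖τ‖) →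
        ∀ (Hh : Submodule ℝ H) (Qh : Submodule ℝ Q),
          IsClosed (Hh : Set H) → IsClosed (Qh : Set Q) →
          (∀ σh ∈ Hh, ∀ uh ∈ Qh, ∃ τh ∈ Hh, ∃ vh ∈ Qh,
            ‖τh‖ ^ 2 + ‖vh‖ ^ 2 ≤ ‖σh‖ ^ 2 + ‖uh‖ ^ 2 ∧
            ‖σh‖ ^ 2 + ‖uh‖ ^ 2 ≤ CJ * (a σh τh + b τh uh + b σh vh)) →
          ∀ (f : Q) (σ : H) (u : Q) (σh : H) (uh : Q),
            σh ∈ Hh → uh ∈ Qh →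
            (∀ τ : H, a σ τ + b τ u + c u τ = 0) →
            (∀ v : Q, b σ v = -⟪f, v⟫) →
            (∀ τ ∈ Hh, a σh τ + b τ uh + c uh τ = 0) →
            (∀ v ∈ Qh, b σh v = -⟪f, v⟫) →
            ∀ σI ∈ Hh, ∀ uI ∈ Qh,
              ‖σ - σh‖ ^ 2 + ‖u - uh‖ ^ 2 ≤
                Chat ^ 2 * (‖σ - σI‖ ^ 2 + ‖u - uI‖ ^ 2) := by
  set k : ℝ := βhat / ν with hk
  have hkpos : 0 < k := div_pos hβ hν
  have hnpos : 0 < 1 / ν := by positivity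
  set n : ℝ := 1 / ν with hn
  set d : ℝ := 1 / CJ - k with hd
  set K : ℝ := n + 2 + k with hK
  have hKpos : 0 < K := by positivity
  have hKd : 0 < K / d := div_pos hKpos hsmall
  refine ⟨2 * (K / d + 1), by positivity, ?_⟩
  intro a b c ha hb hc Hh Qh _ _ hinf f σ u σh uh hσh huh h1 h2 h3 h4 σI hσI uI huI
  obtain ⟨τ, hτ, v, hv, hle, hB⟩ := hinf (σh - σI) (Hh.sub_mem hσh hσI) (uh - uI) (Qh.sub_mem huh huI)
  have e1 := h1 τ
  have e2 := h2 v
  have e3 := h3 τ hτ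
  have e4 := h4 v hv
  have key : a (σh - σI) τ + b τ (uh - uI) + b (σh - σI) v
      = a (σ - σI) τ + b τ (u - uI) + b (σ - σI) v + c (u - uI) τ - c (uh - uI) τ := by
    simp only [map_sub, LinearMap.sub_apply]
    linarith
  rw [key] at hB
  have t1 : ‖σ - σh‖ ≤ ‖σ - σI‖ + ‖σh - σI‖ := by
    have := norm_sub_le (σ - σI) (σh - σI)
    rwa [sub_sub_sub_cancel_right] at this
  have t2 : ‖u - uh‖ ≤ ‖u - uI‖ + ‖uh - uI‖ := by
    have := norm_sub_le (u - uI) (uh - uI)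
    rwa [sub_sub_sub_cancel_right] at this
  have b1 := (le_abs_self _).trans (ha (σ - σI) τ)
  have b2 := (le_abs_self _).trans (hb τ (u - uI))
  have b3 := (le_abs_self _).trans (hb (σ - σI) v)
  have b4 := (le_abs_self _).trans (hc (u - uI) τ)
  have b5 := (neg_le_abs _).trans (hc (uh - uI) τ)
  obtain ⟨E, hE⟩ : ∃ E, E = √(‖σh - σI‖ ^ 2 + ‖uh - uI‖ ^ 2) := ⟨_, rfl⟩
  obtain ⟨P, hP⟩ : ∃ P, P = √(‖σ - σI‖ ^ 2 + ‖u - uI‖ ^ 2) := ⟨_, rfl⟩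
  have hE0 : 0 ≤ E := hE ▸ Real.sqrt_nonneg _
  have hP0 : 0 ≤ P := hP ▸ Real.sqrt_nonneg _
  have hE2 : E ^ 2 = ‖σh - σI‖ ^ 2 + ‖uh - uI‖ ^ 2 := by rw [hE, Real.sq_sqrt (by positivity)]
  have hP2 : P ^ 2 = ‖σ - σI‖ ^ 2 + ‖u - uI‖ ^ 2 := by rw [hP, Real.sq_sqrt (by positivity)]
  rw [← hE2] at hB hle
  have p1 : ‖σ - σI‖ ≤ P := abs_le_of_sq_le_sq' (by linarith [sq_nonneg ‖u - uI‖]) hP0 |>.2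
  have p2 : ‖u - uI‖ ≤ P := abs_le_of_sq_le_sq' (by linarith [sq_nonneg ‖σ - σI‖]) hP0 |>.2
  have p3 : ‖uh - uI‖ ≤ E := abs_le_of_sq_le_sq' (by linarith [sq_nonneg ‖σh - σI‖]) hE0 |>.2
  have p4 : ‖τ‖ ≤ E := abs_le_of_sq_le_sq' (by linarith [sq_nonneg ‖v‖]) hE0 |>.2
  have p5 : ‖v‖ ≤ E := abs_le_of_sq_le_sq' (by linarith [sq_nonneg ‖τ‖]) hE0 |>.2
  have c1 : n * ‖σ - σI‖ * ‖τ‖ ≤ n * P * E := by gcongr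
  have c2 : ‖τ‖ * ‖u - uI‖ ≤ E * P := by gcongr
  have c3 : ‖σ - σI‖ * ‖v‖ ≤ P * E := by gcongr
  have c4 : k * ‖u - uI‖ * ‖τ‖ ≤ k * P * E := by gcongr
  have c5 : k * ‖uh - uI‖ * ‖τ‖ ≤ k * E * E := by gcongr
  have hB' : 1 / CJ * E ^ 2 ≤ K * P * E + k * E * E := by
    rw [one_div, inv_mul_le_iff₀ hCJ]
    refine hB.trans (mul_le_mul_of_nonneg_left ?_ hCJ.le)
    rw [hK]
    linarith
  have hdE : E ≤ K / d * P := by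
    rcases hE0.eq_or_lt with h0 | h0
    · rw [← h0]; positivity
    · rw [div_mul_eq_mul_div, le_div_iff₀ hsmall]
      refine le_of_mul_le_mul_right ?_ h0
      rw [hd]
      linarith
  have s1 := pow_le_pow_left₀ (norm_nonneg _) t1 2
  have s2 := pow_le_pow_left₀ (norm_nonneg _) t2 2
  have s3 := pow_le_pow_left₀ hE0 hdE 2
  rw [← hP2]
  have s4 : ‖σ - σh‖ ^ 2 + ‖u - uh‖ ^ 2 ≤ 2 * P ^ 2 + 2 * E ^ 2 := by
    rw [hP2, hE2]
    linarith [sq_nonneg (‖σ - σI‖ - ‖σh - σI‖), sq_nonneg (‖u - uI‖ - ‖uh - uI‖)]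
  have s5 : 0 ≤ K / d * P ^ 2 := by positivity
  have s6 : 0 ≤ (K / d) ^ 2 * P ^ 2 := by positivity
  have s7 : 0 ≤ P ^ 2 := by positivity
  linarith
end
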